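/- arXiv:1911.12420 — 10 statements merged into one kernel-verified Lean document; each statement's English description precedes it below -/
import Mathlib

section
/- Let u, v ∈ ℂ³. Then the two conditions 'Re(det[u | v | w]) = 0 for every w ∈ ℂ³' and 'Im⟪u,v⟫ = 0' hold simultaneously if and only if u and v are linearly dependent over ℝ. (This is the pointwise model of the statement that the infinitesimal generators U, V at a point p of a nearly Kähler six-manifold with two-torus symmetry are linearly dependent over ℝ exactly when p is critical for the multi-moment map ν = σ(U,V) and ν vanishes at p.) -/
open ComplexConjugate

/-- A complex number `c` with `Re (c * z) = 0` for every `z` vanishes. -/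
theorem Complex.eq_zero_of_forall_re_mul_eq_zero {c : ℂ} (h : ∀ z : ℂ, (c * z).re = 0) :
    c = 0 := by
  have h1 := h 1
  have hI := h Complex.I
  apply Complex.ext <;> simp_all

/-- The real part of `det[u | v | w]` vanishes for every `w` iff `u` and `v` have zero
cross product. -/
theorem forall_re_det_eq_zero_iff_crossProduct (u v : Fin 3 → ℂ) :
    (∀ w : Fin 3 → ℂ, ((Matrix.of ![u, v, w]).transpose.det).re = 0) ↔
      crossProduct u v = 0 := by
  have hdet (w : Fin 3 → ℂ) :
      (Matrix.of ![u, v, w]).transpose.det = crossProduct u v ⬝ᵥ w := by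
    rw [Matrix.det_transpose, Matrix.det_fin_three]
    simp [cross_apply, dotProduct, Fin.sum_univ_three]
    ring
  simp only [hdet]
  refine ⟨fun h => funext fun i => ?_, fun h w => by simp [h]⟩
  refine Complex.eq_zero_of_forall_re_mul_eq_zero fun z => ?_
  simpa using h (Pi.single i z)

/-- If `u` and `v` have zero cross product, then `|u|² v = ⟪u, v⟫ u`. -/
theorem sum_conj_mul_self_smul_eq_of_crossProduct_eq_zero {u v : Fin 3 → ℂ}
    (h : crossProduct u v = 0) :
    (∑ i, conj (u i) * u i) • v = (∑ i, conj (u i) * v i) • u := by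
  have h0 := congrFun h 0
  have h1 := congrFun h 1
  have h2 := congrFun h 2
  simp only [cross_apply, Matrix.cons_val, Pi.zero_apply] at h0 h1 h2
  funext i
  simp only [Fin.sum_univ_three, Pi.smul_apply, smul_eq_mul]
  fin_cases i <;> simp only [Fin.zero_eta, Fin.mk_one, Fin.reduceFinMk]
  · linear_combination conj (u 2) * h1 - conj (u 1) * h2
  · linear_combination conj (u 0) * h2 - conj (u 2) * h0
  · linear_combination conj (u 1) * h0 - conj (u 0) * h1

/-- Pointwise model of Proposition 2.1(1): for `u v : ℂ³`, the conditions
`Re(det[u|v|w]) = 0` for all `w` and `Im⟪u,v⟫ = 0` hold simultaneously iff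
`u` and `v` are linearly dependent over `ℝ`. -/
theorem stmt_1 (u v : Fin 3 → ℂ) :
    ((∀ w : Fin 3 → ℂ, ((Matrix.of ![u, v, w]).transpose.det).re = 0) ∧
        (∑ i, conj (u i) * v i).im = 0) ↔
      ¬ LinearIndependent ℝ ![u, v] := by
  rw [forall_re_det_eq_zero_iff_crossProduct]
  constructor
  · rintro ⟨hcross, him⟩ hli
    have hu : u ≠ 0 := by simpa using hli.ne_zero 0
    have hnorm : ∑ i, conj (u i) * u i = ((∑ i, Complex.normSq (u i) : ℝ) : ℂ) := by
      simp [Complex.normSq_eq_conj_mul_self]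
    have hinner : ∑ i, conj (u i) * v i = ((∑ i, conj (u i) * v i).re : ℂ) :=
      Complex.ext (by simp) (by simpa using him)
    have hrel := sum_conj_mul_self_smul_eq_of_crossProduct_eq_zero hcross
    rw [hnorm, hinner] at hrel
    have hzero := (LinearIndependent.pair_iff.1 hli (-(∑ i, conj (u i) * v i).re)
      (∑ i, Complex.normSq (u i)) (by
        rw [neg_smul, neg_add_eq_zero]
        exact hrel.symm)).2
    rw [Finset.sum_eq_zero_iff_of_nonneg fun i _ => Complex.normSq_nonneg _] at hzero
    exact hu (funext fun i => Complex.normSq_eq_zero.1 (hzero i (Finset.mem_univ i)))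
  · intro hld
    by_cases hu : u = 0
    · simp [hu]
    · rw [LinearIndependent.pair_iff' hu] at hld
      push Not at hld
      obtain ⟨r, rfl⟩ := hld
      refine ⟨?_, ?_⟩
      · rw [← Complex.coe_smul, map_smul, cross_self, smul_zero]
      · rw [Complex.im_sum]
        refine Finset.sum_eq_zero fun i _ => ?_
        simp
        ring
end

section
/- Let (z₁, z₂, z₃, t) ∈ ℂ³ × ℝ satisfy Re(z₁z₂z₃) = 0. Then there exist θ, φ ∈ ℝ such that Re(e^{iθ}z₁) = 0, e^{iφ}z₂ is a nonnegative real number, and e^{−i(θ+φ)}z₃ is a nonnegative real number. (This is the key step identifying the orbit space ν_{S⁶}^{-1}(0)/T² with S³/ℤ₂², where ν_{S⁶}(z₁,z₂,z₃,t) = 3Re(z₁z₂z₃) is the multi-moment map of the torus action on the nearly Kähler six-sphere.) -/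
theorem Complex.exp_neg_arg_mul_I_mul_self (z : ℂ) :
    Complex.exp (-(z.arg : ℂ) * Complex.I) * z = (‖z‖ : ℂ) := by
  nth_rw 2 [← Complex.norm_mul_exp_arg_mul_I z]
  rw [mul_left_comm, ← Complex.exp_add, neg_mul, neg_add_cancel, Complex.exp_zero, mul_one]

theorem Complex.re_exp_pi_div_two_sub_arg_mul_I_mul_self (z : ℂ) :
    (Complex.exp (((Real.pi / 2 - z.arg : ℝ) : ℂ) * Complex.I) * z).re = 0 := by
  have hsplit : ((Real.pi / 2 - z.arg : ℝ) : ℂ) * Complex.I =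
      (Real.pi : ℂ) / 2 * Complex.I + -(z.arg : ℂ) * Complex.I := by
    push_cast
    ring
  rw [hsplit, Complex.exp_add, Complex.exp_pi_div_two_mul_I, mul_assoc,
    Complex.exp_neg_arg_mul_I_mul_self]
  simp

/-- If `Re(z₁z₂z₃) = 0` then there is a torus element `(e^{iθ}, e^{iφ})` moving
`(z₁, z₂, z₃)` to a triple whose first entry is purely imaginary and whose second and
third entries are nonnegative reals: the key step identifying `ν_{S⁶}⁻¹(0)/T²` with
`S³/ℤ₂²`. -/
theorem stmt_4 (z₁ z₂ z₃ : ℂ) (t : ℝ) (h : (z₁ * z₂ * z₃).re = 0) :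
    ∃ θ φ : ℝ,
      (Complex.exp (θ * Complex.I) * z₁).re = 0 ∧
      (∃ r : ℝ, 0 ≤ r ∧ Complex.exp (φ * Complex.I) * z₂ = (r : ℂ)) ∧
      (∃ s : ℝ, 0 ≤ s ∧ Complex.exp (-(θ + φ) * Complex.I) * z₃ = (s : ℂ)) := by
  by_cases h₂ : z₂ = 0
  · refine ⟨Real.pi / 2 - z₁.arg, z₃.arg - (Real.pi / 2 - z₁.arg),
      Complex.re_exp_pi_div_two_sub_arg_mul_I_mul_self z₁, ⟨0, le_rfl, by simp [h₂]⟩,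
      ‖z₃‖, norm_nonneg _, ?_⟩
    rw [← Complex.exp_neg_arg_mul_I_mul_self z₃]
    congr 3
    push_cast
    ring
  have hφ : Complex.exp (((-z₂.arg : ℝ) : ℂ) * Complex.I) * z₂ = (‖z₂‖ : ℂ) := by
    rw [Complex.ofReal_neg]
    exact Complex.exp_neg_arg_mul_I_mul_self z₂
  by_cases h₃ : z₃ = 0
  · exact ⟨Real.pi / 2 - z₁.arg, -z₂.arg,
      Complex.re_exp_pi_div_two_sub_arg_mul_I_mul_self z₁, ⟨‖z₂‖, norm_nonneg _, hφ⟩,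
      0, le_rfl, by simp [h₃]⟩
  refine ⟨z₂.arg + z₃.arg, -z₂.arg, ?_, ⟨‖z₂‖, norm_nonneg _, hφ⟩, ‖z₃‖, norm_nonneg _, ?_⟩
  · have hprod : z₁ * z₂ * z₃ = ((‖z₂‖ * ‖z₃‖ : ℝ) : ℂ) *
        (Complex.exp (((z₂.arg + z₃.arg : ℝ) : ℂ) * Complex.I) * z₁) := by
      conv_lhs => rw [← Complex.norm_mul_exp_arg_mul_I z₂, ← Complex.norm_mul_exp_arg_mul_I z₃]
      push_cast
      rw [add_mul, Complex.exp_add]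
      ring
    rw [hprod, Complex.re_ofReal_mul] at h
    exact (mul_eq_zero.mp h).resolve_left
      (mul_ne_zero (norm_ne_zero_iff.mpr h₂) (norm_ne_zero_iff.mpr h₃))
  · rw [← Complex.exp_neg_arg_mul_I_mul_self z₃]
    congr 3
    push_cast
    ring
end

section
/- Let x = (x¹, …, x⁷) ∈ ℝ⁷ with (x¹)² + ⋯ + (x⁷)² = 1. Then the six equations x⁴x⁵ − x²x³ = 0, x⁴x⁶ + x¹x³ = 0, x⁵x⁶ + x¹x² = 0, x¹x⁵ − x²x⁶ = 0, x¹x⁴ − x³x⁶ = 0, x²x⁴ + x³x⁵ = 0 hold simultaneously if and only if x lies on one of the three two-spheres: (1) x² = x³ = x⁴ = x⁵ = 0 (so (x¹)² + (x⁶)² + (x⁷)² = 1), (2) x¹ = x³ = x⁴ = x⁶ = 0 (so (x²)² + (x⁵)² + (x⁷)² = 1), (3) x¹ = x² = x⁵ = x⁶ = 0 (so (x³)² + (x⁴)² + (x⁷)² = 1). (These six equations express the vanishing of the G₂ cross product P(U,V) of the infinitesimal generators of the torus action on the nearly Kähler six-sphere, i.e., they cut out the set of critical points of the multi-moment map ν_{S⁶}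 on which ν_{S⁶} vanishes.) -/
/-- If `(a + b i) (c + d i) = 0`, then one of the two factors vanishes, in real coordinates. -/
theorem eq_zero_or_eq_zero_of_complex_mul_eq_zero {a b c d : ℝ}
    (hre : a * c - b * d = 0) (him : a * d + b * c = 0) :
    (a = 0 ∧ b = 0) ∨ (c = 0 ∧ d = 0) := by
  have hmul : (⟨a, b⟩ : ℂ) * ⟨c, d⟩ = 0 := Complex.ext hre him
  simpa [Complex.ext_iff] using mul_eq_zero.mp hmul

/-- Part of Proposition 3.3: on the unit sphere in `ℝ⁷`, the six equations expressing the
vanishing of the G₂ cross product `P(U,V)` of the infinitesimal generators of the torus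
action hold simultaneously iff the point lies on one of three two-spheres. -/
theorem stmt_5 (x1 x2 x3 x4 x5 x6 x7 : ℝ)
    (h : x1 ^ 2 + x2 ^ 2 + x3 ^ 2 + x4 ^ 2 + x5 ^ 2 + x6 ^ 2 + x7 ^ 2 = 1) :
    (x4 * x5 - x2 * x3 = 0 ∧
     x4 * x6 + x1 * x3 = 0 ∧
     x5 * x6 + x1 * x2 = 0 ∧
     x1 * x5 - x2 * x6 = 0 ∧
     x1 * x4 - x3 * x6 = 0 ∧
     x2 * x4 + x3 * x5 = 0) ↔
      ((x2 = 0 ∧ x3 = 0 ∧ x4 = 0 ∧ x5 = 0) ∨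
       (x1 = 0 ∧ x3 = 0 ∧ x4 = 0 ∧ x6 = 0) ∨
       (x1 = 0 ∧ x2 = 0 ∧ x5 = 0 ∧ x6 = 0)) := by
  constructor
  · rintro ⟨h23re, h13im, h12im, h12re, h13re, h23im⟩
    have h12 : (x1 = 0 ∧ x6 = 0) ∨ (x5 = 0 ∧ x2 = 0) :=
      eq_zero_or_eq_zero_of_complex_mul_eq_zero (by linarith) (by linarith)
    have h13 : (x1 = 0 ∧ x6 = 0) ∨ (x4 = 0 ∧ x3 = 0) :=
      eq_zero_or_eq_zero_of_complex_mul_eq_zero (by linarith) (by linarith)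
    have h23 : (x5 = 0 ∧ x2 = 0) ∨ (x4 = 0 ∧ x3 = 0) :=
      eq_zero_or_eq_zero_of_complex_mul_eq_zero (by linarith) (by linarith)
    tauto
  · rintro (⟨rfl, rfl, rfl, rfl⟩ | ⟨rfl, rfl, rfl, rfl⟩ | ⟨rfl, rfl, rfl, rfl⟩) <;> simp
end

section
/- Let p = (p_{ij})_{1≤i,j≤3} be a special unitary 3×3 complex matrix (p·p* = Id, det p = 1). Then Im(p₂₁p̄₂₂p̄₃₁p₃₂ − p₂₁p̄₂₃p̄₃₁p₃₃ + p₂₂p̄₂₃p̄₃₂p₃₃) = 3·Im(p₂₂p̄₂₃p̄₃₂p₃₃). (This is the simplification, using the orthogonality relation p₂₁p̄₃₁ + p₂₂p̄₃₂ + p₂₃p̄₃₃ = 0, that identifies the multi-moment map on the flag manifold F₁,₂(ℂ³) = SU(3)/T² as ν(p) = −27·Im(p₂₂p̄₂₃p̄₃₂p₃₃).) -/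
open ComplexConjugate

/-- If `a + b + c = 0`, the three cyclic cross terms `Im(a b̄)`, `Im(c ā)`, `Im(b c̄)` agree. -/
lemma im_mul_conj_sub_add_of_add_eq_zero {a b c : ℂ} (h : a + b + c = 0) :
    (a * conj b - a * conj c + b * conj c).im = 3 * (b * conj c).im := by
  obtain rfl : a = -b - c := by linear_combination h
  simp only [Complex.add_im, Complex.sub_im, Complex.mul_im, Complex.conj_re, Complex.conj_im,
    Complex.sub_re, Complex.neg_re, Complex.neg_im]
  ring

/-- Simplification identifying the multi-moment map on the flag manifold: for
`p ∈ SU(3)`, `Im(p₂₁p̄₂₂p̄₃₁p₃₂ − p₂₁p̄₂₃p̄₃₁p₃₃ + p₂₂p̄₂₃p̄₃₂p₃₃) = 3 Im(p₂₂p̄₂₃p̄₃₂p₃₃)`. -/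
theorem stmt_7 (p : Matrix (Fin 3) (Fin 3) ℂ)
    (hu : p * p.conjTranspose = 1) (hd : p.det = 1) :
    (p 1 0 * conj (p 1 1) * conj (p 2 0) * p 2 1 -
      p 1 0 * conj (p 1 2) * conj (p 2 0) * p 2 2 +
      p 1 1 * conj (p 1 2) * conj (p 2 1) * p 2 2).im =
    3 * (p 1 1 * conj (p 1 2) * conj (p 2 1) * p 2 2).im := by
  have h : p 1 0 * conj (p 2 0) + p 1 1 * conj (p 2 1) + p 1 2 * conj (p 2 2) = 0 := by
    simpa [Matrix.mul_apply, Fin.sum_univ_three] using congr_fun₂ hu 1 2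
  convert im_mul_conj_sub_add_of_add_eq_zero h using 2
  · simp only [map_mul, Complex.conj_conj]
    ring
  · simp only [map_mul, Complex.conj_conj]
    ring_nf
end

section
/- For every special unitary 3×3 complex matrix p = (p_{ij}) one has |Im(p₂₂p̄₂₃p̄₃₂p₃₃)| ≤ √3/18. (Equivalently, the multi-moment map ν(p) = −27·Im(p₂₂p̄₂₃p̄₃₂p₃₃) on the flag manifold SU(3)/T² takes values in [−3√3/2, 3√3/2]; the only critical orbits with non-zero critical value are the two orbits realizing these extrema.) -/
open ComplexConjugate

/-- The AM-GM inequality for three nonnegative reals, in polynomial form. -/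
theorem mul_mul_le_add_add_pow_three {u v w : ℝ} (hu : 0 ≤ u) (hv : 0 ≤ v) (hw : 0 ≤ w) :
    27 * (u * v * w) ≤ (u + v + w) ^ 3 := by
  nlinarith [mul_nonneg hu (sq_nonneg (v - w)), mul_nonneg hv (sq_nonneg (u - w)),
    mul_nonneg hw (sq_nonneg (u - v)), mul_nonneg hu (sq_nonneg (u - v)),
    mul_nonneg hu (sq_nonneg (u - w)), mul_nonneg hv (sq_nonneg (v - w)),
    mul_nonneg hv (sq_nonneg (u - v)), mul_nonneg hw (sq_nonneg (u - w)),
    mul_nonneg hw (sq_nonneg (v - w))]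

/-- Heron's formula for the triangle with sides `z`, `w`, `z + w`. -/
theorem four_mul_im_mul_conj_sq (z w : ℂ) :
    4 * (z * conj w).im ^ 2 = (‖z‖ + ‖w‖ + ‖z + w‖) *
      ((‖w‖ + ‖z + w‖ - ‖z‖) * (‖z‖ + ‖z + w‖ - ‖w‖) * (‖z‖ + ‖w‖ - ‖z + w‖)) := by
  have hz := Complex.sq_norm z
  have hw := Complex.sq_norm w
  have hs := Complex.sq_norm (z + w)
  have expand : ∀ a b c : ℝ, (a + b + c) * ((b + c - a) * (a + c - b) * (a + b - c)) =
      4 * a ^ 2 * b ^ 2 - (c ^ 2 - a ^ 2 - b ^ 2) ^ 2 := by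
    intro a b c; ring
  rw [expand, hz, hw, hs]
  simp only [Complex.normSq_apply, Complex.mul_im, Complex.conj_re, Complex.conj_im,
    Complex.add_re, Complex.add_im]
  ring

/-- The isoperimetric inequality for triangles, with the perimeter bounded by one. -/
theorem abs_im_mul_conj_le (z w : ℂ) (h : ‖z‖ + ‖w‖ + ‖z + w‖ ≤ 1) :
    |(z * conj w).im| ≤ Real.sqrt 3 / 18 := by
  have hu : 0 ≤ ‖w‖ + ‖z + w‖ - ‖z‖ := by
    have := norm_sub_le (z + w) w
    rw [add_sub_cancel_right] at this
    linarith
  have hv : 0 ≤ ‖z‖ + ‖z + w‖ - ‖w‖ := by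
    have := norm_sub_le (z + w) z
    rw [add_sub_cancel_left] at this
    linarith
  have hw : 0 ≤ ‖z‖ + ‖w‖ - ‖z + w‖ := sub_nonneg.2 (norm_add_le z w)
  have hL : 0 ≤ ‖z‖ + ‖w‖ + ‖z + w‖ := by positivity
  have amgm := mul_mul_le_add_add_pow_three hu hv hw
  have hsum : ‖w‖ + ‖z + w‖ - ‖z‖ + (‖z‖ + ‖z + w‖ - ‖w‖) + (‖z‖ + ‖w‖ - ‖z + w‖) =
      ‖z‖ + ‖w‖ + ‖z + w‖ := by ring
  rw [hsum] at amgm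
  have heron := four_mul_im_mul_conj_sq z w
  have hmul := mul_le_mul_of_nonneg_left amgm hL
  have hpow : (‖z‖ + ‖w‖ + ‖z + w‖) ^ 4 ≤ 1 := pow_le_one₀ hL h
  apply abs_le_of_sq_le_sq _ (by positivity)
  rw [div_pow, Real.sq_sqrt (by norm_num)]
  linarith

/-- For every `p ∈ SU(3)` one has `|Im(p₂₂p̄₂₃p̄₃₂p₃₃)| ≤ √3/18`: the multi-moment map
`ν(p) = −27 Im(p₂₂p̄₂₃p̄₃₂p₃₃)` on the flag manifold takes values in `[−3√3/2, 3√3/2]`. -/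
theorem stmt_8 (p : Matrix (Fin 3) (Fin 3) ℂ)
    (hu : p * p.conjTranspose = 1) (hd : p.det = 1) :
    |(p 1 1 * conj (p 1 2) * conj (p 2 1) * p 2 2).im| ≤ Real.sqrt 3 / 18 := by
  have row_norm : ∀ i, ‖p i 0‖ ^ 2 + ‖p i 1‖ ^ 2 + ‖p i 2‖ ^ 2 = 1 := by
    intro i
    have h := congrFun (congrFun hu i) i
    simp only [Matrix.mul_apply, Fin.sum_univ_three, Matrix.conjTranspose_apply,
      Matrix.one_apply_eq, Complex.star_def, Complex.mul_conj'] at h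
    exact_mod_cast h
  have orth : p 1 0 * conj (p 2 0) + p 1 1 * conj (p 2 1) + p 1 2 * conj (p 2 2) = 0 := by
    have h := congrFun (congrFun hu 1) 2
    simpa [Matrix.mul_apply, Fin.sum_univ_three] using h
  have key := abs_im_mul_conj_le (p 1 1 * conj (p 2 1)) (p 1 2 * conj (p 2 2)) (by
    have hneg : p 1 1 * conj (p 2 1) + p 1 2 * conj (p 2 2) = -(p 1 0 * conj (p 2 0)) := by
      linear_combination orth
    rw [hneg, norm_neg]
    simp only [norm_mul, RCLike.norm_conj]
    linarith [row_norm 1, row_norm 2, two_mul_le_add_sq ‖p 1 0‖ ‖p 2 0‖,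
      two_mul_le_add_sq ‖p 1 1‖ ‖p 2 1‖, two_mul_le_add_sq ‖p 1 2‖ ‖p 2 2‖])
  convert key using 3
  simp only [map_mul, Complex.conj_conj]
  ring
end

section
/- Let ω = e^{2πi/3} and let p = (1/√3)·[[iω, i, iω²], [1, 1, 1], [ω², 1, ω]]. Then p is a special unitary 3×3 complex matrix (p·p* = Id and det p = 1) and Im(p₂₂p̄₂₃p̄₃₂p₃₃) = √3/18; hence the bound |Im(p₂₂p̄₂₃p̄₃₂p₃₃)| ≤ √3/18 on SU(3) is attained, and the multi-moment map ν(p) = −27·Im(p₂₂p̄₂₃p̄₃₂p₃₃) attains its minimum on the torus orbit of p. -/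
open ComplexConjugate

/-- The primitive cube root of unity `ω = e^{2πi/3}`. -/
noncomputable def omega3 : ℂ := Complex.exp (2 * Real.pi * Complex.I / 3)

/-- The matrix `p = (1/√3)·[[iω, i, iω²], [1, 1, 1], [ω², 1, ω]]` realizing the minimum
of the multi-moment map on the flag manifold. -/
noncomputable def pCrit : Matrix (Fin 3) (Fin 3) ℂ :=
  ((Real.sqrt 3 : ℂ))⁻¹ •
    !![Complex.I * omega3, Complex.I, Complex.I * omega3 ^ 2;
       1, 1, 1;
       omega3 ^ 2, 1, omega3]

/-- The Cartesian form of the primitive cube root of unity. -/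
theorem omega3_eq : omega3 = ⟨-1 / 2, Real.sqrt 3 / 2⟩ := by
  have angle : (2 * Real.pi * Complex.I / 3 : ℂ) =
      ((Real.pi - Real.pi / 3 : ℝ) : ℂ) * Complex.I := by
    push_cast
    ring
  rw [omega3, angle]
  apply Complex.ext
  · rw [Complex.exp_ofReal_mul_I_re, Real.cos_pi_sub, Real.cos_pi_div_three]
    norm_num
  · rw [Complex.exp_ofReal_mul_I_im, Real.sin_pi_sub, Real.sin_pi_div_three]

theorem conj_omega3 : conj omega3 = omega3 ^ 2 := by
  have h : Real.sqrt 3 ^ 2 = 3 := Real.sq_sqrt (by norm_num)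
  rw [omega3_eq]
  apply Complex.ext <;> simp [pow_two] <;> linarith

theorem omega3_sq : omega3 ^ 2 = -1 - omega3 := by
  rw [← conj_omega3, omega3_eq]
  apply Complex.ext <;> simp
  norm_num

theorem omega3_sq_sub : omega3 ^ 2 - omega3 = -(Real.sqrt 3 * Complex.I) := by
  rw [← conj_omega3, omega3_eq]
  apply Complex.ext <;> simp
  ring

theorem ofReal_sqrt_three_sq : (Real.sqrt 3 : ℂ) ^ 2 = 3 := by
  exact_mod_cast Real.sq_sqrt (show (0 : ℝ) ≤ 3 by norm_num)

theorem inv_ofReal_sqrt_three_sq : ((Real.sqrt 3 : ℂ)⁻¹) ^ 2 = 3⁻¹ := by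
  rw [inv_pow, ofReal_sqrt_three_sq]

theorem pCrit_mul_conjTranspose : pCrit * pCrit.conjTranspose = 1 := by
  have hs := inv_ofReal_sqrt_three_sq
  have hI := Complex.I_sq
  have hw := omega3_sq
  ext i j
  fin_cases i <;> fin_cases j <;>
    simp [pCrit, Matrix.mul_apply, Fin.sum_univ_three, conj_omega3, Complex.conj_ofReal,
      -inv_pow] <;>
    grind

theorem det_pCrit : pCrit.det = 1 := by
  have hs := ofReal_sqrt_three_sq
  have hs0 : (Real.sqrt 3 : ℂ) ≠ 0 := by
    intro h
    simp [h] at hs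
  have hdet : pCrit.det =
      ((Real.sqrt 3 : ℂ)⁻¹) ^ 3 * (Complex.I * (3 * (omega3 ^ 2 - omega3))) := by
    have hw := omega3_sq
    rw [pCrit, Matrix.det_smul, Matrix.det_fin_three]
    simp
    grind
  rw [hdet, omega3_sq_sub]
  field_simp
  linear_combination -3 * Complex.I_sq - hs

theorem im_pCrit_minor :
    (pCrit 1 1 * conj (pCrit 1 2) * conj (pCrit 2 1) * pCrit 2 2).im = Real.sqrt 3 / 18 := by
  have h : pCrit 1 1 * conj (pCrit 1 2) * conj (pCrit 2 1) * pCrit 2 2 =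
      ((1 / 9 : ℝ) : ℂ) * omega3 := by
    have hs := inv_ofReal_sqrt_three_sq
    simp [pCrit, Complex.conj_ofReal, -inv_pow]
    grind
  rw [h, Complex.im_ofReal_mul, omega3_eq]
  ring

/-- The matrix `pCrit` lies in `SU(3)` and attains `Im(p₂₂p̄₂₃p̄₃₂p₃₃) = √3/18`, so the
bound `|Im(p₂₂p̄₂₃p̄₃₂p₃₃)| ≤ √3/18` on `SU(3)` is attained and the multi-moment map
`ν(p) = −27 Im(p₂₂p̄₂₃p̄₃₂p₃₃)` attains its minimum on the torus orbit of `pCrit`. -/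
theorem stmt_9 :
    pCrit * pCrit.conjTranspose = 1 ∧ pCrit.det = 1 ∧
    (pCrit 1 1 * conj (pCrit 1 2) * conj (pCrit 2 1) * pCrit 2 2).im =
      Real.sqrt 3 / 18 :=
  ⟨pCrit_mul_conjTranspose, det_pCrit, im_pCrit_minor⟩
end

section
/- Let p be a special unitary 3×3 complex matrix with Im(p₂₂p̄₂₃p̄₃₂p₃₃) = 0. Then there exist diagonal special unitary matrices t = diag(e^{iθ₁}, e^{iθ₂}, e^{iθ₃}) and s = diag(e^{iψ₁}, e^{iψ₂}, e^{iψ₃}) (with θ₁+θ₂+θ₃ ≡ 0 and ψ₁+ψ₂+ψ₃ ≡ 0 mod 2π) such that every entry in the second and third rows of t·p·s is real. (This is the key step identifying the orbit space ν^{-1}(0)/T² for the flag manifold with F₁,₂(ℝ³)/ℤ₂².) -/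
open ComplexConjugate

/-- Two complex numbers with `x * conj y` real can be made real by a common rotation. -/
theorem exists_rotation_im_eq_zero {x y : ℂ} (h : (x * conj y).im = 0) :
    ∃ θ : ℝ, (Complex.exp (θ * Complex.I) * x).im = 0 ∧
      (Complex.exp (θ * Complex.I) * y).im = 0 := by
  have rot (z : ℂ) : Complex.exp ((-z.arg : ℝ) * Complex.I) * z = ‖z‖ := by
    have hz : Complex.exp ((-z.arg : ℝ) * Complex.I) * Complex.exp (z.arg * Complex.I) = 1 := by
      rw [← Complex.exp_add]
      simp
    linear_combination (‖z‖ : ℂ) * hz -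
      Complex.exp ((-z.arg : ℝ) * Complex.I) * Complex.norm_mul_exp_arg_mul_I z
  by_cases hx : x = 0
  · exact ⟨-y.arg, by simp [hx], by rw [rot, Complex.ofReal_im]⟩
  refine ⟨-x.arg, by rw [rot, Complex.ofReal_im], ?_⟩
  have hn : ‖x‖ ≠ 0 := norm_ne_zero_iff.mpr hx
  have hr := rot x
  set e := Complex.exp ((-x.arg : ℝ) * Complex.I)
  have he : e * conj e = 1 := by
    rw [Complex.mul_conj, Complex.normSq_eq_norm_sq, Complex.norm_exp_ofReal_mul_I]
    simp
  have hmul : (‖x‖ : ℂ) * (e * y) = conj (x * conj y) := by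
    rw [← Complex.conj_ofReal, ← hr, map_mul, map_mul, Complex.conj_conj]
    linear_combination (conj x * y) * he
  have := congrArg Complex.im hmul
  rw [Complex.im_ofReal_mul, Complex.conj_im, h, neg_zero] at this
  exact (mul_eq_zero.mp this).resolve_left hn

/-- If `p ∈ SU(3)` satisfies `Im(p₂₂p̄₂₃p̄₃₂p₃₃) = 0`, then `p` can be moved by diagonal
special unitary matrices `t = diag(e^{iθ₁},e^{iθ₂},e^{iθ₃})` on the left and
`s = diag(e^{iψ₁},e^{iψ₂},e^{iψ₃})` on the right so that `t·p·s` has real second and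
third rows: the key step identifying `ν⁻¹(0)/T²` with `F₁,₂(ℝ³)/ℤ₂²`. -/
theorem stmt_10 (p : Matrix (Fin 3) (Fin 3) ℂ)
    (hu : p * p.conjTranspose = 1) (hd : p.det = 1)
    (h : (p 1 1 * conj (p 1 2) * conj (p 2 1) * p 2 2).im = 0) :
    ∃ θ ψ : Fin 3 → ℝ,
      Complex.exp ((θ 0 + θ 1 + θ 2) * Complex.I) = 1 ∧
      Complex.exp ((ψ 0 + ψ 1 + ψ 2) * Complex.I) = 1 ∧
      ∀ i j : Fin 3, i ≠ 0 →
        ((((Matrix.diagonal fun k => Complex.exp (θ k * Complex.I)) * p *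
          (Matrix.diagonal fun k => Complex.exp (ψ k * Complex.I))) i j).im = 0) := by
  have horth : p 1 0 * conj (p 2 0) + p 1 1 * conj (p 2 1) + p 1 2 * conj (p 2 2) = 0 := by
    simpa [Matrix.mul_apply, Fin.sum_univ_three] using congrFun (congrFun hu 1) 2
  obtain ⟨α, h₁, h₂⟩ := exists_rotation_im_eq_zero
    (x := p 1 1 * conj (p 2 1)) (y := p 1 2 * conj (p 2 2)) (by
      rw [← h]
      congr 1
      simp only [map_mul, Complex.conj_conj]
      ring)
  have hα (j : Fin 3) : (Complex.exp (α * Complex.I) * p 1 j * conj (p 2 j)).im = 0 := by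
    rw [mul_assoc]
    fin_cases j
    · have h₀ : Complex.exp (α * Complex.I) * (p 1 0 * conj (p 2 0)) =
          -(Complex.exp (α * Complex.I) * (p 1 1 * conj (p 2 1)) +
            Complex.exp (α * Complex.I) * (p 1 2 * conj (p 2 2))) := by
        linear_combination Complex.exp (α * Complex.I) * horth
      change (Complex.exp (α * Complex.I) * (p 1 0 * conj (p 2 0))).im = 0
      rw [h₀, Complex.neg_im, Complex.add_im, h₁, h₂, add_zero, neg_zero]
    · exact h₁
    · exact h₂
  choose β hβ₁ hβ₂ using fun j => exists_rotation_im_eq_zero (hα j)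
  obtain ⟨σ, hσ⟩ : ∃ σ : ℝ, 3 * σ = β 0 + β 1 + β 2 := ⟨(β 0 + β 1 + β 2) / 3, by ring⟩
  have hσ' : (3 * σ : ℂ) = β 0 + β 1 + β 2 := by exact_mod_cast hσ
  refine ⟨![-α - 2 * σ, α + σ, σ], fun j => β j - σ, ?_, ?_, fun i j hi => ?_⟩
  · rw [Complex.exp_eq_one_iff]
    exact ⟨0, by simp; ring⟩
  · rw [Complex.exp_eq_one_iff]
    exact ⟨0, by push_cast; linear_combination -Complex.I * hσ'⟩
  · rw [Matrix.mul_diagonal, Matrix.diagonal_mul]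
    fin_cases i
    · exact absurd rfl hi
    · convert hβ₁ j using 2
      change Complex.exp ((α + σ : ℝ) * Complex.I) * p 1 j * _ = _
      rw [mul_right_comm, ← mul_assoc, ← Complex.exp_add, ← Complex.exp_add]
      push_cast
      ring_nf
    · convert hβ₂ j using 2
      change Complex.exp (σ * Complex.I) * p 2 j * _ = _
      rw [mul_right_comm, ← Complex.exp_add]
      push_cast
      ring_nf
end

section
/- Let a, b, c, d ∈ ℂ satisfy Im(ā·b·c·d̄) = 0. Then there exist θ, φ, ψ ∈ ℝ such that e^{i(θ−ψ)}a, e^{i(θ+ψ)}b, e^{i(φ−ψ)}c and e^{i(φ+ψ)}d are all real. (This is the key step identifying the orbit space ν^{-1}(0)/T² for the nearly Kähler ℂP³ with ℝP³/ℤ₂².) -/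
open ComplexConjugate

/-- The imaginary part of a rotated complex number, in polar form. -/
lemma im_exp_mul_I_mul (t : ℝ) (z : ℂ) :
    (Complex.exp (t * Complex.I) * z).im = ‖z‖ * Real.sin (t + z.arg) := by
  conv_lhs => rw [← Complex.norm_mul_exp_arg_mul_I z]
  rw [mul_left_comm, ← Complex.exp_add, ← add_mul, ← Complex.ofReal_add, Complex.im_ofReal_mul,
    Complex.exp_ofReal_mul_I_im]

/-- The imaginary part of `conj a * b * c * conj d`, in polar form. -/
lemma im_conj_mul_mul_mul_conj (a b c d : ℂ) :
    (conj a * b * c * conj d).im =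
      ‖a‖ * ‖b‖ * ‖c‖ * ‖d‖ * Real.sin (b.arg + c.arg - a.arg - d.arg) := by
  have polar : conj a * b * c * conj d = ((‖a‖ * ‖b‖ * ‖c‖ * ‖d‖ : ℝ) : ℂ) *
      Complex.exp ((b.arg + c.arg - a.arg - d.arg : ℝ) * Complex.I) := by
    have conj_polar (z : ℂ) : conj z = ‖z‖ * Complex.exp (-(z.arg * Complex.I)) := by
      conv_lhs => rw [← Complex.norm_mul_exp_arg_mul_I z]
      rw [map_mul, Complex.conj_ofReal, ← Complex.exp_conj, map_mul, Complex.conj_ofReal,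
        Complex.conj_I, mul_neg]
    rw [conj_polar a, conj_polar d]
    conv_lhs => rw [← Complex.norm_mul_exp_arg_mul_I b, ← Complex.norm_mul_exp_arg_mul_I c]
    have exp_split : Complex.exp ((b.arg + c.arg - a.arg - d.arg : ℝ) * Complex.I) =
        Complex.exp (-(a.arg * Complex.I)) * Complex.exp (b.arg * Complex.I) *
          Complex.exp (c.arg * Complex.I) * Complex.exp (-(d.arg * Complex.I)) := by
      simp only [← Complex.exp_add]
      congr 1
      push_cast
      ring
    rw [exp_split]
    push_cast
    ring
  rw [polar, Complex.im_ofReal_mul, Complex.exp_ofReal_mul_I_im]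

/-- Phases `α, β, γ, δ` with `α + δ = β + γ` come from an element of the torus. -/
lemma exists_torus_of_phases {a b c d : ℂ} (α β γ δ : ℝ) (sum_eq : α + δ = β + γ)
    (ha : ‖a‖ * Real.sin (α + a.arg) = 0) (hb : ‖b‖ * Real.sin (β + b.arg) = 0)
    (hc : ‖c‖ * Real.sin (γ + c.arg) = 0) (hd : ‖d‖ * Real.sin (δ + d.arg) = 0) :
    ∃ θ φ ψ : ℝ,
      (Complex.exp ((θ - ψ) * Complex.I) * a).im = 0 ∧
      (Complex.exp ((θ + ψ) * Complex.I) * b).im = 0 ∧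
      (Complex.exp ((φ - ψ) * Complex.I) * c).im = 0 ∧
      (Complex.exp ((φ + ψ) * Complex.I) * d).im = 0 := by
  refine ⟨(α + β) / 2, (γ + δ) / 2, (β - α) / 2, ?_⟩
  simp only [← Complex.ofReal_add, ← Complex.ofReal_sub, im_exp_mul_I_mul]
  rw [show (α + β) / 2 - (β - α) / 2 = α by ring, show (α + β) / 2 + (β - α) / 2 = β by ring,
    show (γ + δ) / 2 - (β - α) / 2 = γ by linarith,
    show (γ + δ) / 2 + (β - α) / 2 = δ by linarith]
  exact ⟨ha, hb, hc, hd⟩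

/-- If `Im(ā·b·c·d̄) = 0`, then the torus action
`(a,b,c,d) ↦ (e^{i(θ−ψ)}a, e^{i(θ+ψ)}b, e^{i(φ−ψ)}c, e^{i(φ+ψ)}d)` can move `(a,b,c,d)`
to a real vector: the key step identifying `ν⁻¹(0)/T²` for the nearly Kähler `ℂP³` with
`ℝP³/ℤ₂²`. -/
theorem stmt_14 (a b c d : ℂ) (h : (conj a * b * c * conj d).im = 0) :
    ∃ θ φ ψ : ℝ,
      (Complex.exp ((θ - ψ) * Complex.I) * a).im = 0 ∧
      (Complex.exp ((θ + ψ) * Complex.I) * b).im = 0 ∧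
      (Complex.exp ((φ - ψ) * Complex.I) * c).im = 0 ∧
      (Complex.exp ((φ + ψ) * Complex.I) * d).im = 0 := by
  rw [im_conj_mul_mul_mul_conj] at h
  simp only [mul_eq_zero] at h
  rcases h with (((ha | hb) | hc) | hd) | hsin
  · exact exists_torus_of_phases (-b.arg - c.arg + d.arg) (-b.arg) (-c.arg) (-d.arg) (by ring)
      (by simp [ha]) (by simp) (by simp) (by simp)
  · exact exists_torus_of_phases (-a.arg) (-a.arg - d.arg + c.arg) (-c.arg) (-d.arg) (by ring)
      (by simp) (by simp [hb]) (by simp) (by simp)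
  · exact exists_torus_of_phases (-a.arg) (-b.arg) (-a.arg - d.arg + b.arg) (-d.arg) (by ring)
      (by simp) (by simp) (by simp [hc]) (by simp)
  · exact exists_torus_of_phases (-a.arg) (-b.arg) (-c.arg) (-b.arg - c.arg + a.arg) (by ring)
      (by simp) (by simp) (by simp) (by simp [hd])
  · refine exists_torus_of_phases (-a.arg) (-b.arg) (-c.arg) (-b.arg - c.arg + a.arg) (by ring)
      (by simp) (by simp) (by simp) ?_
    rw [show -b.arg - c.arg + a.arg + d.arg = -(b.arg + c.arg - a.arg - d.arg) by ring,
      Real.sin_neg, hsin, neg_zero, mul_zero]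
end

section
/- Let b₁, b₂, b₃ be nonzero real numbers and let x = (x¹,x²,x³), y = (y¹,y²,y³) ∈ ℝ³ be unit vectors. Then the five equations b₃(x³y² − x²y³) = 0, b₃(x¹y² − x²y¹) − b₂x² = 0, b₃(x¹y³ − x³y¹) − b₂x³ = 0, b₃(x²y¹ − x¹y²) − b₁y² = 0, b₃(x³y¹ − x¹y³) − b₁y³ = 0 hold simultaneously if and only if either (a) x² = x³ = y² = y³ = 0, or (b) b₂x² = −b₁y², b₂x³ = −b₁y³, x¹ = (b₁²b₃² − b₁²b₂² − b₂²b₃²)/(2b₁b₂²b₃) and y¹ = (b₂²b₃² − b₁²b₂² − b₁²b₃²)/(2b₁²b₂b₃). (This is the characterization of the critical points of the multi-moment map on the nearly Kähler S³ × S³ when all components of b are nonzero.) -/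
/-- Characterization of the critical points of the multi-moment map on the nearly Kähler
`S³ × S³` when all components of `b = a₁ × a₂` are nonzero: for unit vectors
`x, y ∈ ℝ³`, the five critical-point equations hold iff either `x² = x³ = y² = y³ = 0`,
or `b₂x² = −b₁y²`, `b₂x³ = −b₁y³` and `x¹, y¹` equal the explicit values. -/
theorem stmt_17 (b₁ b₂ b₃ x₁ x₂ x₃ y₁ y₂ y₃ : ℝ)
    (hb₁ : b₁ ≠ 0) (hb₂ : b₂ ≠ 0) (hb₃ : b₃ ≠ 0)
    (hx : x₁ ^ 2 + x₂ ^ 2 + x₃ ^ 2 = 1) (hy : y₁ ^ 2 + y₂ ^ 2 + y₃ ^ 2 = 1) :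
    (b₃ * (x₃ * y₂ - x₂ * y₃) = 0 ∧
     b₃ * (x₁ * y₂ - x₂ * y₁) - b₂ * x₂ = 0 ∧
     b₃ * (x₁ * y₃ - x₃ * y₁) - b₂ * x₃ = 0 ∧
     b₃ * (x₂ * y₁ - x₁ * y₂) - b₁ * y₂ = 0 ∧
     b₃ * (x₃ * y₁ - x₁ * y₃) - b₁ * y₃ = 0) ↔
    ((x₂ = 0 ∧ x₃ = 0 ∧ y₂ = 0 ∧ y₃ = 0) ∨
     (b₂ * x₂ = -(b₁ * y₂) ∧ b₂ * x₃ = -(b₁ * y₃) ∧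
      x₁ = (b₁ ^ 2 * b₃ ^ 2 - b₁ ^ 2 * b₂ ^ 2 - b₂ ^ 2 * b₃ ^ 2) / (2 * b₁ * b₂ ^ 2 * b₃) ∧
      y₁ = (b₂ ^ 2 * b₃ ^ 2 - b₁ ^ 2 * b₂ ^ 2 - b₁ ^ 2 * b₃ ^ 2) / (2 * b₁ ^ 2 * b₂ * b₃))) := by
  constructor
  · rintro ⟨-, h₂, h₃, h₄, h₅⟩
    have e₂ : b₂ * x₂ = -(b₁ * y₂) := by linear_combination -h₂ - h₄
    have e₃ : b₂ * x₃ = -(b₁ * y₃) := by linear_combination -h₃ - h₅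
    by_cases hL : b₃ * (b₂ * x₁ + b₁ * y₁) + b₁ * b₂ = 0
    · have hN : (b₂ * x₁) ^ 2 - (b₁ * y₁) ^ 2 = b₂ ^ 2 - b₁ ^ 2 := by
        linear_combination b₂ ^ 2 * hx - b₁ ^ 2 * hy - (b₂ * x₂ - b₁ * y₂) * e₂ -
          (b₂ * x₃ - b₁ * y₃) * e₃
      refine Or.inr ⟨e₂, e₃, ?_, ?_⟩
      · rw [eq_div_iff (by positivity)]
        linear_combination (b₁ * b₂ + b₃ * (b₂ * x₁ - b₁ * y₁)) * hL - b₃ ^ 2 * hN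
      · rw [eq_div_iff (by positivity)]
        linear_combination (b₁ * b₂ - b₃ * (b₂ * x₁ - b₁ * y₁)) * hL + b₃ ^ 2 * hN
    · have hy₂ : y₂ = 0 := (mul_eq_zero.mp (show
        (b₃ * (b₂ * x₁ + b₁ * y₁) + b₁ * b₂) * y₂ = 0 by
          linear_combination b₂ * h₂ + (b₃ * y₁ + b₂) * e₂)).resolve_left hL
      have hy₃ : y₃ = 0 := (mul_eq_zero.mp (show
        (b₃ * (b₂ * x₁ + b₁ * y₁) + b₁ * b₂) * y₃ = 0 by
          linear_combination b₂ * h₃ + (b₃ * y₁ + b₂) * e₃)).resolve_left hL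
      exact Or.inl ⟨by simpa [hy₂, hb₂] using e₂, by simpa [hy₃, hb₂] using e₃, hy₂, hy₃⟩
  · rintro (⟨rfl, rfl, rfl, rfl⟩ | ⟨e₂, e₃, hx₁, hy₁⟩)
    · simp
    · have hL : b₃ * (b₂ * x₁ + b₁ * y₁) + b₁ * b₂ = 0 := by
        rw [hx₁, hy₁]
        field_simp
        ring
      have h₂ : b₃ * (x₁ * y₂ - x₂ * y₁) - b₂ * x₂ = 0 := mul_left_cancel₀ hb₂ (by
        linear_combination y₂ * hL - (b₃ * y₁ + b₂) * e₂)
      have h₃ : b₃ * (x₁ * y₃ - x₃ * y₁) - b₂ * x₃ = 0 := mul_left_cancel₀ hb₂ (by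
        linear_combination y₃ * hL - (b₃ * y₁ + b₂) * e₃)
      refine ⟨mul_left_cancel₀ hb₂ ?_, h₂, h₃, ?_, ?_⟩
      · linear_combination b₃ * y₂ * e₃ - b₃ * y₃ * e₂
      · linear_combination -h₂ - e₂
      · linear_combination -h₃ - e₃
end

section
/- Let b₁, b₂, b₃ be nonzero real numbers and let x, y ∈ ℝ³ be unit vectors satisfying the five equations b₃(x³y² − x²y³) = 0, b₃(x¹y² − x²y¹) − b₂x² = 0, b₃(x¹y³ − x³y¹) − b₂x³ = 0, b₃(x²y¹ − x¹y²) − b₁y² = 0, b₃(x³y¹ − x¹y³) − b₁y³ = 0, and suppose (x², x³, y², y³) ≠ (0,0,0,0). Then 1 − ⟨x,y⟩² = (b₁²/b₃²)(1 − (y¹)²) and ⟨x,y⟩² = ((b₂²b₃² − b₁²b₂² + b₁²b₃²)/(2b₁b₂b₃²))². (This computes the two non-degenerate critical values of the multi-moment map on the nearly Kähler S³ × S³: ν = (2/(3√3))(−b₁b₂/b₃ ± (b₂²b₃² − b₁²b₂² + b₁²b₃²)/(2b₁b₂b₃)).) -/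
/-- Computation of the non-degenerate critical values of the multi-moment map on the
nearly Kähler `S³ × S³`: if unit vectors `x, y ∈ ℝ³` satisfy the five critical-point
equations (with `b₁, b₂, b₃` nonzero) and `(x², x³, y², y³) ≠ (0,0,0,0)`, then
`1 − ⟨x,y⟩² = (b₁²/b₃²)(1 − (y¹)²)` and
`⟨x,y⟩² = ((b₂²b₃² − b₁²b₂² + b₁²b₃²)/(2b₁b₂b₃²))²`. -/
theorem stmt_18 (b₁ b₂ b₃ x₁ x₂ x₃ y₁ y₂ y₃ : ℝ)
    (hb₁ : b₁ ≠ 0) (hb₂ : b₂ ≠ 0) (hb₃ : b₃ ≠ 0)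
    (hx : x₁ ^ 2 + x₂ ^ 2 + x₃ ^ 2 = 1) (hy : y₁ ^ 2 + y₂ ^ 2 + y₃ ^ 2 = 1)
    (e1 : b₃ * (x₃ * y₂ - x₂ * y₃) = 0)
    (e2 : b₃ * (x₁ * y₂ - x₂ * y₁) - b₂ * x₂ = 0)
    (e3 : b₃ * (x₁ * y₃ - x₃ * y₁) - b₂ * x₃ = 0)
    (e4 : b₃ * (x₂ * y₁ - x₁ * y₂) - b₁ * y₂ = 0)
    (e5 : b₃ * (x₃ * y₁ - x₁ * y₃) - b₁ * y₃ = 0)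
    (hne : ¬(x₂ = 0 ∧ x₃ = 0 ∧ y₂ = 0 ∧ y₃ = 0)) :
    1 - (x₁ * y₁ + x₂ * y₂ + x₃ * y₃) ^ 2 = b₁ ^ 2 / b₃ ^ 2 * (1 - y₁ ^ 2) ∧
    (x₁ * y₁ + x₂ * y₂ + x₃ * y₃) ^ 2 =
      ((b₂ ^ 2 * b₃ ^ 2 - b₁ ^ 2 * b₂ ^ 2 + b₁ ^ 2 * b₃ ^ 2) /
        (2 * b₁ * b₂ * b₃ ^ 2)) ^ 2 := by
  have h2 : b₂ * x₂ + b₁ * y₂ = 0 := by linear_combination -e2 - e4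
  have h3 : b₂ * x₃ + b₁ * y₃ = 0 := by linear_combination -e3 - e5
  have hy23 : y₂ ≠ 0 ∨ y₃ ≠ 0 := by
    by_contra! h
    obtain ⟨rfl, rfl⟩ := h
    simp_all
  have hK : b₃ * (b₁ * y₁ + b₂ * x₁) = -(b₁ * b₂) := by
    rcases hy23 with h | h
    · refine mul_right_cancel₀ h ?_
      linear_combination b₃ * y₁ * h2 - b₂ * e4
    · refine mul_right_cancel₀ h ?_
      linear_combination b₃ * y₁ * h3 - b₂ * e5
  have hsq : (b₂ * x₁) ^ 2 - (b₁ * y₁) ^ 2 = b₂ ^ 2 - b₁ ^ 2 := by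
    linear_combination b₂ ^ 2 * hx - b₁ ^ 2 * hy - (b₂ * x₂ - b₁ * y₂) * h2
      - (b₂ * x₃ - b₁ * y₃) * h3
  have hS : b₁ * b₂ * (x₁ * y₁ + x₂ * y₂ + x₃ * y₃) =
      b₁ * y₁ * (b₁ * y₁ + b₂ * x₁) - b₁ ^ 2 := by
    linear_combination b₁ * y₂ * h2 + b₁ * y₃ * h3 - b₁ ^ 2 * hy
  have hN : (x₁ * y₁ + x₂ * y₂ + x₃ * y₃) * (2 * b₁ * b₂ * b₃ ^ 2) =
      -(b₂ ^ 2 * b₃ ^ 2 - b₁ ^ 2 * b₂ ^ 2 + b₁ ^ 2 * b₃ ^ 2) := by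
    linear_combination 2 * b₃ ^ 2 * hS - b₃ ^ 2 * hsq
      + (b₃ * (b₁ * y₁ + b₂ * x₁) - b₁ * b₂) * hK
  constructor
  · -- Lagrange's identity turns the left-hand side into the squared norm of `x × y`.
    have hlag : 1 - (x₁ * y₁ + x₂ * y₂ + x₃ * y₃) ^ 2 = (x₃ * y₂ - x₂ * y₃) ^ 2 +
        (x₂ * y₁ - x₁ * y₂) ^ 2 + (x₃ * y₁ - x₁ * y₃) ^ 2 := by
      linear_combination -(y₁ ^ 2 + y₂ ^ 2 + y₃ ^ 2) * hx - hy
    rw [hlag, div_mul_eq_mul_div, eq_div_iff (pow_ne_zero 2 hb₃)]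
    linear_combination b₃ * (x₃ * y₂ - x₂ * y₃) * e1
      + (b₃ * (x₂ * y₁ - x₁ * y₂) + b₁ * y₂) * e4
      + (b₃ * (x₃ * y₁ - x₁ * y₃) + b₁ * y₃) * e5 + b₁ ^ 2 * hy
  · rw [eq_div_of_mul_eq (by positivity) hN, neg_div, neg_sq]
end
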